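/- Let d1, d2 be positive integers, α > 0, R = √r α with r = R²/α², and let 0 < γ ≤ 1 be such that B := r/γ² is a positive integer with B ≤ min(d1, d2). Then there exists a finite set 𝓜 ⊆ κ(α, R) := {M ∈ ℝ^{d1×d2} : ‖M‖_{1→2} ≤ α, ‖M‖_mixed ≤ R} of cardinality |𝓜| = ⌈exp(r · max(d1,d2) / (16 γ²))⌉ such that: (1) every M ∈ 𝓜 has rank(M) ≤ r/γ², every entry of M lies in {±γα/√d1}, ‖M‖_{1→2} = γα, and ‖M‖_F² = γ² α² d2; and (2) any two distinct M, M' ∈ 𝓜 satisfy ‖M − M'‖_F² ≥ γ² α² d2 / 2. -/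

import Mathlib

open Real Set Matrix

noncomputable def frobNorm {m n : ℕ} (M : Matrix (Fin m) (Fin n) ℝ) : ℝ :=
  Real.sqrt (∑ i, ∑ j, (M i j)^2)

/-- maximum ℓ2 norm of the columns of `M`, i.e. `‖M‖_{1→2}` -/
noncomputable def norm12 {m n : ℕ} (M : Matrix (Fin m) (Fin n) ℝ) : ℝ :=
  ⨆ j, Real.sqrt (∑ i, (M i j)^2)

/-- `‖M‖_mixed = inf { ‖U‖_F ‖Vᵀ‖_{1→2} : M = U Vᵀ }` -/
noncomputable def mixedNorm {d1 d2 : ℕ} (M : Matrix (Fin d1) (Fin d2) ℝ) : ℝ :=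
  sInf {c | ∃ (d : ℕ) (U : Matrix (Fin d1) (Fin d) ℝ) (V : Matrix (Fin d2) (Fin d) ℝ),
    M = U * Vᵀ ∧ c = frobNorm U * norm12 Vᵀ}

section HammingCodes

variable {ι κ : Type*} [Fintype ι] [DecidableEq ι] [Fintype κ]

/-- The generating function of the Hamming distance to a fixed binary word. -/
lemma sum_exp_neg_hammingDist (c : ι → Bool) :
    ∑ x : ι → Bool, Real.exp (-(hammingDist c x : ℝ)) =
      (1 + Real.exp (-1)) ^ Fintype.card ι := by
  have hprod : ∀ x : ι → Bool, Real.exp (-(hammingDist c x : ℝ)) =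
      ∏ i, if c i ≠ x i then Real.exp (-1) else 1 := by
    intro x
    rw [Finset.prod_ite, Finset.prod_const, Finset.prod_const_one, mul_one, ← Real.exp_nat_mul]
    simp [hammingDist]
  have hfactor : ∀ i, ∑ b : Bool, (if c i ≠ b then Real.exp (-1) else 1) = 1 + Real.exp (-1) := by
    intro i
    cases c i <;> simp [add_comm]
  simp_rw [hprod]
  rw [← Fintype.prod_sum (fun i (b : Bool) => if c i ≠ b then Real.exp (-1) else (1 : ℝ))]
  simp_rw [hfactor]
  simp

/-- Chernoff bound for the volume of Hamming balls of relative radius `1 / 4`. -/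
lemma card_hammingBall_le (c : ι → Bool) :
    (({x : ι → Bool | 4 * hammingDist c x < Fintype.card ι} : Finset _).card : ℝ) ≤
      2 ^ Fintype.card ι * Real.exp (-(Fintype.card ι / 8 : ℝ)) := by
  set n := Fintype.card ι
  set s : Finset (ι → Bool) := {x | 4 * hammingDist c x < n} with hs
  have hmarkov : (s.card : ℝ) * Real.exp (-(n / 4 : ℝ)) ≤ (1 + Real.exp (-1)) ^ n := by
    rw [← sum_exp_neg_hammingDist c, ← nsmul_eq_mul, ← Finset.sum_const]
    calc ∑ _x ∈ s, Real.exp (-(n / 4 : ℝ))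
        ≤ ∑ x ∈ s, Real.exp (-(hammingDist c x : ℝ)) := by
          refine Finset.sum_le_sum fun x hx => Real.exp_le_exp.2 ?_
          have hlt : 4 * hammingDist c x < n := by simpa [hs] using hx
          have hlt' : (4 * hammingDist c x : ℝ) < n := by exact_mod_cast hlt
          linarith
      _ ≤ _ := Finset.sum_le_sum_of_subset_of_nonneg (Finset.subset_univ _)
          fun _ _ _ => (Real.exp_pos _).le
  have hbase : 1 + Real.exp (-1) ≤ 2 * Real.exp (-(3 / 8)) := by
    have hcosh := Real.cosh_le_exp_half_sq (1 / 2)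
    rw [Real.cosh_eq] at hcosh
    have hmul := mul_le_mul_of_nonneg_right hcosh (Real.exp_pos (-(1 / 2))).le
    rw [div_mul_eq_mul_div, add_mul, ← Real.exp_add, ← Real.exp_add, ← Real.exp_add] at hmul
    norm_num at hmul ⊢
    linarith
  have hpow : (1 + Real.exp (-1)) ^ n ≤ 2 ^ n * Real.exp (-(3 / 8) * n) := by
    refine (pow_le_pow_left₀ (by positivity) hbase n).trans_eq ?_
    rw [mul_pow, ← Real.exp_nat_mul, mul_comm (n : ℝ)]
  calc (s.card : ℝ) = s.card * Real.exp (-(n / 4 : ℝ)) * Real.exp (n / 4 : ℝ) := by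
        rw [mul_assoc, ← Real.exp_add]; simp
    _ ≤ 2 ^ n * Real.exp (-(3 / 8) * n) * Real.exp (n / 4 : ℝ) := by
        exact mul_le_mul_of_nonneg_right (hmarkov.trans hpow) (Real.exp_pos _).le
    _ = _ := by
        rw [mul_assoc, ← Real.exp_add]
        congr 2
        ring

/-- Gilbert–Varshamov bound: there are binary codes of relative distance `1 / 4` and of any size
up to `⌈exp (n / 8)⌉`. -/
lemma exists_code_card_eq (k : ℕ) (hk : (k : ℝ) < Real.exp (Fintype.card ι / 8 : ℝ) + 1) :
    ∃ S : Finset (ι → Bool), S.card = k ∧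
      ∀ x ∈ S, ∀ y ∈ S, x ≠ y → Fintype.card ι ≤ 4 * hammingDist x y := by
  induction k with
  | zero => exact ⟨∅, by simp⟩
  | succ k ih =>
    push_cast at hk
    obtain ⟨S, hcard, hS⟩ := ih (by linarith)
    set n := Fintype.card ι with hn
    let T : Finset (ι → Bool) := S.biUnion fun c => {x | 4 * hammingDist c x < n}
    have hT : (T.card : ℝ) < 2 ^ n := by
      calc (T.card : ℝ)
          ≤ ∑ c ∈ S, (({x : ι → Bool | 4 * hammingDist c x < n} : Finset _).card : ℝ) := by
            exact_mod_cast Finset.card_biUnion_le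
        _ ≤ ∑ _c ∈ S, 2 ^ n * Real.exp (-(n / 8 : ℝ)) :=
            Finset.sum_le_sum fun c _ => card_hammingBall_le c
        _ = k * (2 ^ n * Real.exp (-(n / 8 : ℝ))) := by simp [hcard]
        _ < Real.exp (n / 8 : ℝ) * (2 ^ n * Real.exp (-(n / 8 : ℝ))) := by
            gcongr
            linarith
        _ = 2 ^ n := by
            rw [mul_left_comm, ← Real.exp_add]; simp
    obtain ⟨w, hw⟩ : ∃ w, w ∉ T := by
      by_contra! hall
      have huniv : T = Finset.univ := Finset.eq_univ_of_forall hall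
      rw [huniv, Finset.card_univ] at hT
      simp [hn] at hT
    have hdist : ∀ c ∈ S, n ≤ 4 * hammingDist c w := by
      intro c hc
      by_contra! hlt
      exact hw (Finset.mem_biUnion.2 ⟨c, hc, by simpa using hlt⟩)
    have hwS : w ∉ S := by
      intro hwS
      have hn0 : n = 0 := by simpa using hdist w hwS
      have hk1 : 1 ≤ k := hcard ▸ Finset.card_pos.2 ⟨w, hwS⟩
      have hk1' : (1 : ℝ) ≤ k := by exact_mod_cast hk1
      rw [hn0, Nat.cast_zero, zero_div, Real.exp_zero] at hk
      linarith
    refine ⟨insert w S, by rw [Finset.card_insert_of_notMem hwS, hcard], ?_⟩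
    intro x hx y hy hxy
    rcases Finset.mem_insert.1 hx with rfl | hxS <;>
      rcases Finset.mem_insert.1 hy with rfl | hyS
    · exact absurd rfl hxy
    · rw [hammingDist_comm]
      exact hdist y hyS
    · exact hdist x hxS
    · exact hS x hxS y hyS hxy

/-- Repeating every letter of two words at least `m` times multiplies their distance by at
least `m`. -/
lemma mul_hammingDist_le_hammingDist_comp (f : κ → ι) (m : ℕ)
    (hf : ∀ k, m ≤ ({z | f z = k} : Finset κ).card) (x y : ι → Bool) :
    m * hammingDist x y ≤ hammingDist (x ∘ f) (y ∘ f) := by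
  unfold hammingDist
  refine Finset.mul_card_image_le_card_of_maps_to (f := f) (fun z hz => by simpa using hz) m
    fun k hk => (hf k).trans (Finset.card_le_card fun z hz => ?_)
  obtain rfl : f z = k := by simpa using hz
  simpa using hk

end HammingCodes

/-- Under reduction modulo `B ≤ d`, every residue has at least `d / B` preimages below `d`. -/
lemma div_le_card_filter_mod_eq {d B : ℕ} (b : Fin B) :
    d / B ≤ ({j | (j : ℕ) % B = b} : Finset (Fin d)).card := by
  have hlt : ∀ q : Fin (d / B), B * q + b < d := fun q => by
    calc B * (q : ℕ) + b < B * (q + 1) := by rw [mul_add]; omega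
      _ ≤ B * (d / B) := Nat.mul_le_mul_left _ q.2
      _ ≤ d := Nat.mul_div_le d B
  have hle := Finset.card_le_card_of_injOn (s := (Finset.univ : Finset (Fin (d / B))))
    (t := ({j | (j : ℕ) % B = b} : Finset (Fin d))) (fun q => ⟨B * q + b, hlt q⟩)
    (fun q _ => by simp [Nat.mod_eq_of_lt b.2])
    (fun q _ q' _ hq => by
      have hB : 0 < B := b.pos
      simpa [Fin.ext_iff, hB.ne'] using hq)
  simpa using hle

lemma le_two_mul_mul_div {d B : ℕ} (hB : 0 < B) (hBd : B ≤ d) : d ≤ 2 * (B * (d / B)) := by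
  have hmod := Nat.div_add_mod d B
  have hlt := Nat.mod_lt d hB
  have hpos : 1 ≤ d / B := (Nat.one_le_div_iff hB).2 hBd
  have := Nat.mul_le_mul_left B hpos
  omega

section SignMatrices

/-- The matrix with entries `±s`, with signs read from a binary word through `f`. -/
def signMatrix {ι : Type*} {m n : ℕ} (s : ℝ) (f : Fin m × Fin n → ι) (x : ι → Bool) :
    Matrix (Fin m) (Fin n) ℝ :=
  Matrix.of fun i j => if x (f (i, j)) then s else -s

variable {ι : Type*} {m n : ℕ} (s : ℝ) (f : Fin m × Fin n → ι) (x y : ι → Bool)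

lemma signMatrix_eq_or (i : Fin m) (j : Fin n) :
    signMatrix s f x i j = s ∨ signMatrix s f x i j = -s := by
  by_cases h : x (f (i, j)) <;> simp [signMatrix, h]

lemma signMatrix_sq (i : Fin m) (j : Fin n) : signMatrix s f x i j ^ 2 = s ^ 2 := by
  rcases signMatrix_eq_or s f x i j with h | h <;> simp [h]

lemma frobNorm_sq (M : Matrix (Fin m) (Fin n) ℝ) : frobNorm M ^ 2 = ∑ i, ∑ j, M i j ^ 2 :=
  Real.sq_sqrt (by positivity)

lemma norm12_nonneg (M : Matrix (Fin m) (Fin n) ℝ) : 0 ≤ norm12 M :=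
  Real.iSup_nonneg fun _ => Real.sqrt_nonneg _

lemma frobNorm_signMatrix_sq : frobNorm (signMatrix s f x) ^ 2 = m * n * s ^ 2 := by
  rw [frobNorm_sq]
  simp [signMatrix_sq, mul_assoc]

lemma norm12_signMatrix [NeZero n] (hs : 0 ≤ s) :
    norm12 (signMatrix s f x) = Real.sqrt m * s := by
  simp [norm12, signMatrix_sq, Real.sqrt_sq hs]

lemma frobNorm_signMatrix (hs : 0 ≤ s) :
    frobNorm (signMatrix s f x) = Real.sqrt (m * n) * s := by
  have hnonneg : 0 ≤ frobNorm (signMatrix s f x) := Real.sqrt_nonneg _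
  rw [← Real.sqrt_sq hnonneg, frobNorm_signMatrix_sq, Real.sqrt_mul (by positivity),
    Real.sqrt_sq hs]

lemma frobNorm_signMatrix_sub_sq :
    frobNorm (signMatrix s f x - signMatrix s f y) ^ 2 =
      4 * s ^ 2 * hammingDist (x ∘ f) (y ∘ f) := by
  have hentry : ∀ z : Fin m × Fin n,
      (signMatrix s f x - signMatrix s f y) z.1 z.2 ^ 2 =
        4 * s ^ 2 * if (x ∘ f) z ≠ (y ∘ f) z then 1 else 0 := by
    rintro ⟨i, j⟩
    cases hx : x (f (i, j)) <;> cases hy : y (f (i, j)) <;> simp [signMatrix, hx, hy] <;> ring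
  rw [frobNorm_sq, ← Fintype.sum_prod_type'
    (fun i j => (signMatrix s f x - signMatrix s f y) i j ^ 2)]
  simp_rw [hentry]
  rw [← Finset.mul_sum, Finset.sum_boole]
  rfl

lemma mixedNorm_mul_transpose_le {d : ℕ} (U : Matrix (Fin m) (Fin d) ℝ)
    (V : Matrix (Fin n) (Fin d) ℝ) : mixedNorm (U * Vᵀ) ≤ frobNorm U * norm12 Vᵀ := by
  refine csInf_le ⟨0, ?_⟩ ⟨d, U, V, rfl, rfl⟩
  rintro _ ⟨d, U, V, -, rfl⟩
  exact mul_nonneg (Real.sqrt_nonneg _) (norm12_nonneg _)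

/-- The matrix of a selection `p`: multiplying by it on the left repeats rows according to `p`. -/
def selectionMatrix {m B : ℕ} (p : Fin m → Fin B) : Matrix (Fin m) (Fin B) ℝ :=
  Matrix.of fun i b => if p i = b then 1 else 0

lemma frobNorm_selectionMatrix {B : ℕ} (p : Fin m → Fin B) :
    frobNorm (selectionMatrix p) = Real.sqrt m := by
  simp [frobNorm, selectionMatrix, ite_pow]

lemma norm12_selectionMatrix_transpose {B : ℕ} [NeZero m] (p : Fin m → Fin B) :
    norm12 (selectionMatrix p)ᵀ = 1 := by
  simp [norm12, selectionMatrix, ite_pow]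

lemma signMatrix_repeat_columns {B : ℕ} (p : Fin n → Fin B) (x : Fin m × Fin B → Bool) :
    signMatrix s (Prod.map id p) x = signMatrix s id x * (selectionMatrix p)ᵀ := by
  ext i j
  simp [signMatrix, selectionMatrix, Matrix.mul_apply]

lemma signMatrix_repeat_rows {B : ℕ} (p : Fin m → Fin B) (x : Fin B × Fin n → Bool) :
    signMatrix s (Prod.map p id) x = selectionMatrix p * (signMatrix s id x)ᵀᵀ := by
  ext i j
  simp [signMatrix, selectionMatrix, Matrix.mul_apply, -mul_ite]

/-- A family of sign matrices whose signs are read from a good binary code, provided that each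
letter is repeated often enough. -/
lemma exists_separated_signMatrices [Fintype ι] [DecidableEq ι] (hs : 0 < s)
    (hm : 0 < m) (hn : 0 < n) (c : ℕ)
    (hc : m * n ≤ 2 * (Fintype.card ι * c))
    (hf : ∀ k, c ≤ ({z | f z = k} : Finset (Fin m × Fin n)).card) :
    ∃ 𝓜 : Finset (Matrix (Fin m) (Fin n) ℝ),
      𝓜.card = ⌈Real.exp (Fintype.card ι / 16 : ℝ)⌉₊ ∧
      (∀ M ∈ 𝓜, ∃ x, M = signMatrix s f x) ∧
      ∀ M ∈ 𝓜, ∀ M' ∈ 𝓜, M ≠ M' → m * n * s ^ 2 / 2 ≤ frobNorm (M - M') ^ 2 := by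
  classical
  obtain ⟨S, hcard, hS⟩ := exists_code_card_eq (ι := ι) ⌈Real.exp (Fintype.card ι / 16 : ℝ)⌉₊ <| by
    refine (Nat.ceil_lt_add_one (Real.exp_pos _).le).trans_le ?_
    gcongr
    norm_num
  have hsep : ∀ x ∈ S, ∀ y ∈ S, x ≠ y →
      m * n * s ^ 2 / 2 ≤ frobNorm (signMatrix s f x - signMatrix s f y) ^ 2 := by
    intro x hx y hy hxy
    have hrep := mul_hammingDist_le_hammingDist_comp f c hf x y
    have hcode := Nat.mul_le_mul_right c (hS x hx y hy hxy)
    have hdist : m * n ≤ 8 * hammingDist (x ∘ f) (y ∘ f) := by nlinarith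
    have hdist' : (m * n : ℝ) ≤ 8 * hammingDist (x ∘ f) (y ∘ f) := by exact_mod_cast hdist
    rw [frobNorm_signMatrix_sub_sq]
    nlinarith [mul_le_mul_of_nonneg_right hdist' (sq_nonneg s)]
  have hinj : Set.InjOn (signMatrix s f) S := by
    intro x hx y hy hxy
    by_contra hne
    have hle := hsep x hx y hy hne
    rw [hxy, sub_self] at hle
    have hpos : 0 < m * n * s ^ 2 / 2 := by positivity
    simp [frobNorm] at hle
    linarith
  refine ⟨S.image (signMatrix s f), by rw [Finset.card_image_of_injOn hinj, hcard], ?_, ?_⟩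
  · intro M hM
    obtain ⟨x, -, rfl⟩ := Finset.mem_image.1 hM
    exact ⟨x, rfl⟩
  · intro M hM M' hM' hne
    obtain ⟨x, hx, rfl⟩ := Finset.mem_image.1 hM
    obtain ⟨y, hy, rfl⟩ := Finset.mem_image.1 hM'
    exact hsep x hx y hy fun h => hne (h ▸ rfl)

/-- There is a large separated family of sign matrices with a cheap factorization through
dimension `B`. -/
lemma exists_separated_factored_signMatrices (hs : 0 < s) (hm : 0 < m) (hn : 0 < n)
    {B : ℕ} (hB : 0 < B) (hBle : B ≤ min m n) :
    ∃ 𝓜 : Finset (Matrix (Fin m) (Fin n) ℝ),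
      𝓜.card = ⌈Real.exp (B * max m n / 16 : ℝ)⌉₊ ∧
      (∀ M ∈ 𝓜, (∃ x, M = signMatrix s id x) ∧
        ∃ (U : Matrix (Fin m) (Fin B) ℝ) (V : Matrix (Fin n) (Fin B) ℝ),
          M = U * Vᵀ ∧ frobNorm U * norm12 Vᵀ = Real.sqrt (m * B) * s) ∧
      ∀ M ∈ 𝓜, ∀ M' ∈ 𝓜, M ≠ M' → m * n * s ^ 2 / 2 ≤ frobNorm (M - M') ^ 2 := by
  have : NeZero m := ⟨hm.ne'⟩
  have : NeZero n := ⟨hn.ne'⟩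
  have : NeZero B := ⟨hB.ne'⟩
  let residue (d : ℕ) (i : Fin d) : Fin B := ⟨i % B, Nat.mod_lt _ hB⟩
  rcases le_total n m with h | h
  · have hBn : B ≤ n := hBle.trans (min_le_right _ _)
    obtain ⟨𝓜, hcard, hsign, hsep⟩ := exists_separated_signMatrices s
      (Prod.map (id : Fin m → Fin m) (residue n)) hs hm hn (n / B) (by
        have := Nat.mul_le_mul_left m (le_two_mul_mul_div hB hBn)
        simp only [Fintype.card_prod, Fintype.card_fin]
        linarith) (by
        rintro ⟨i, b⟩
        refine (div_le_card_filter_mod_eq b).trans ?_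
        refine Finset.card_le_card_of_injOn (fun j => (i, j)) ?_ ?_
        · intro j hj
          simpa [residue, Fin.ext_iff] using hj
        · intro j _ j' _ hj
          simpa using hj)
    refine ⟨𝓜, ?_, fun M hM => ?_, hsep⟩
    · rw [hcard, max_eq_left (by exact_mod_cast h)]
      simp [mul_comm]
    · obtain ⟨x, rfl⟩ := hsign M hM
      refine ⟨⟨x ∘ Prod.map id (residue n), rfl⟩, _, _, signMatrix_repeat_columns s _ x, ?_⟩
      rw [norm12_selectionMatrix_transpose, frobNorm_signMatrix _ _ _ hs.le, mul_one]
  · have hBm : B ≤ m := hBle.trans (min_le_left _ _)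
    obtain ⟨𝓜, hcard, hsign, hsep⟩ := exists_separated_signMatrices s
      (Prod.map (residue m) (id : Fin n → Fin n)) hs hm hn (m / B) (by
        have := Nat.mul_le_mul_left n (le_two_mul_mul_div hB hBm)
        simp only [Fintype.card_prod, Fintype.card_fin]
        linarith) (by
        rintro ⟨b, j⟩
        refine (div_le_card_filter_mod_eq b).trans ?_
        refine Finset.card_le_card_of_injOn (fun i => (i, j)) ?_ ?_
        · intro i hi
          simpa [residue, Fin.ext_iff] using hi
        · intro i _ i' _ hi
          simpa using hi)
    refine ⟨𝓜, ?_, fun M hM => ?_, hsep⟩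
    · rw [hcard, max_eq_right (by exact_mod_cast h)]
      simp
    · obtain ⟨x, rfl⟩ := hsign M hM
      refine ⟨⟨x ∘ Prod.map (residue m) id, rfl⟩, _, _, signMatrix_repeat_rows s _ x, ?_⟩
      rw [frobNorm_selectionMatrix, Matrix.transpose_transpose, norm12_signMatrix _ _ _ hs.le,
        Real.sqrt_mul (by positivity), mul_assoc]

end SignMatrices

theorem stmt_17
    (d1 d2 r : ℕ) (hd1 : 0 < d1) (hd2 : 0 < d2) (hr : 0 < r)
    (α R γ : ℝ) (hα : 0 < α) (hR : R = Real.sqrt r * α)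
    (hγ : 0 < γ) (hγ1 : γ ≤ 1)
    (B : ℕ) (hB : (B : ℝ) = r / γ^2) (hBpos : 0 < B) (hBle : B ≤ min d1 d2) :
    ∃ 𝓜 : Finset (Matrix (Fin d1) (Fin d2) ℝ),
      -- 𝓜 ⊆ κ(α, R)
      (∀ M ∈ 𝓜, norm12 M ≤ α ∧ mixedNorm M ≤ R) ∧
      -- cardinality ⌈exp(r·max(d1,d2)/(16γ²))⌉
      𝓜.card = ⌈Real.exp ((r : ℝ) * (max d1 d2) / (16 * γ^2))⌉₊ ∧
      -- property (1)
      (∀ M ∈ 𝓜,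
        ((M.rank : ℝ) ≤ (r : ℝ) / γ^2) ∧
        (∀ i j, M i j = γ * α / Real.sqrt d1 ∨ M i j = -(γ * α / Real.sqrt d1)) ∧
        norm12 M = γ * α ∧
        (frobNorm M)^2 = γ^2 * α^2 * d2) ∧
      -- property (2): separation
      (∀ M ∈ 𝓜, ∀ M' ∈ 𝓜, M ≠ M' →
        (frobNorm (M - M'))^2 ≥ γ^2 * α^2 * d2 / 2) := by
  have : NeZero d2 := ⟨hd2.ne'⟩
  have hd1' : (0 : ℝ) < d1 := by exact_mod_cast hd1
  have hsqrt : 0 < Real.sqrt d1 := Real.sqrt_pos.2 hd1'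
  have hs : 0 < γ * α / Real.sqrt d1 := by positivity
  have hs_sq : (d1 : ℝ) * d2 * (γ * α / Real.sqrt d1) ^ 2 = γ ^ 2 * α ^ 2 * d2 := by
    rw [div_pow, Real.sq_sqrt hd1'.le]
    field_simp
  have hnorm : Real.sqrt d1 * (γ * α / Real.sqrt d1) = γ * α := by field_simp
  have hmixed : Real.sqrt (d1 * B) * (γ * α / Real.sqrt d1) = R := by
    have hBγ : Real.sqrt B * γ = Real.sqrt r := by
      rw [hB, Real.sqrt_div (by positivity), Real.sqrt_sq hγ.le]
      field_simp
    rw [Real.sqrt_mul hd1'.le, mul_right_comm, hnorm, hR, ← hBγ]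
    ring
  obtain ⟨𝓜, hcard, hfam, hsep⟩ :=
    exists_separated_factored_signMatrices (γ * α / Real.sqrt d1) hs hd1 hd2 hBpos hBle
  have hcol : ∀ M ∈ 𝓜, norm12 M = γ * α := by
    intro M hM
    obtain ⟨⟨x, rfl⟩, -⟩ := hfam M hM
    rw [norm12_signMatrix _ _ _ hs.le, hnorm]
  refine ⟨𝓜, fun M hM => ⟨?_, ?_⟩, ?_, fun M hM => ⟨?_, ?_, hcol M hM, ?_⟩, ?_⟩
  · rw [hcol M hM]
    exact mul_le_of_le_one_left hα.le hγ1
  · obtain ⟨-, U, V, rfl, hUV⟩ := hfam M hM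
    exact (mixedNorm_mul_transpose_le U V).trans_eq (hUV.trans hmixed)
  · rw [hcard, hB]
    congr 2
    push_cast
    field_simp
  · obtain ⟨-, U, V, rfl, -⟩ := hfam M hM
    rw [← hB]
    exact_mod_cast (Matrix.rank_mul_le_left U Vᵀ).trans
      ((Matrix.rank_le_card_width U).trans_eq (Fintype.card_fin B))
  · obtain ⟨⟨x, rfl⟩, -⟩ := hfam M hM
    exact signMatrix_eq_or _ _ x
  · obtain ⟨⟨x, rfl⟩, -⟩ := hfam M hM
    rw [frobNorm_signMatrix_sq, hs_sq]
  · intro M hM M' hM' hne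
    rw [← hs_sq]
    exact hsep M hM M' hM' hne
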